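/- arXiv:2301.01100 — 3 statements merged into one kernel-verified Lean document; each statement's English description precedes it below -/
import Mathlib

section
/- Let K ≥ 2, d ≥ K, and let W ∈ ℝ^{d×K} satisfy W^T W = (K/(K-1))·(I_K − (1/K)·1_K 1_K^T), i.e., the Gram matrix of the columns of W has 1 on the diagonal and −1/(K−1) in every off-diagonal entry. Then there exists U ∈ ℝ^{d×K} with U^T U = I_K such that W = √(K/(K-1)) · U · (I_K − (1/K)·1_K 1_K^T); that is, W is a simplex equiangular tight frame. -/
open Matrix

/-- If `Wᵀ W = (K/(K-1)) • (I_K - (1/K) • 1_K 1_Kᵀ)`, then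
`W` is a simplex equiangular tight frame: there exists `U` with `Uᵀ U = I_K`
and `W = √(K/(K-1)) • U * (I_K - (1/K) • 1_K 1_Kᵀ)`. -/
theorem etf_of_gram (K d : ℕ) (hK : 2 ≤ K) (hd : K ≤ d)
    (W : Matrix (Fin d) (Fin K) ℝ)
    (hW : Wᵀ * W = ((K : ℝ) / ((K : ℝ) - 1)) •
      ((1 : Matrix (Fin K) (Fin K) ℝ) -
        ((K : ℝ))⁻¹ • Matrix.of (fun _ _ => (1 : ℝ)))) :
    ∃ U : Matrix (Fin d) (Fin K) ℝ, Uᵀ * U = 1 ∧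
      W = Real.sqrt ((K : ℝ) / ((K : ℝ) - 1)) •
        (U * ((1 : Matrix (Fin K) (Fin K) ℝ) -
          ((K : ℝ))⁻¹ • Matrix.of (fun _ _ => (1 : ℝ)))) := by
  have hK2 : (2 : ℝ) ≤ (K : ℝ) := by exact_mod_cast hK
  have hK0 : (K : ℝ) ≠ 0 := by linarith
  have hK1 : (0 : ℝ) < (K : ℝ) - 1 := by linarith
  have hent : ∀ j k, ∑ i, W i j * W i k =
      (K : ℝ) / ((K : ℝ) - 1) * ((if j = k then 1 else 0) - (K : ℝ)⁻¹) := by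
    intro j k
    have h := congrFun (congrFun hW j) k
    simpa [Matrix.mul_apply, Matrix.one_apply] using h
  have hrow : ∀ i, ∑ j, W i j = 0 := by
    have h1 : ∑ i, (∑ j, W i j) ^ 2 = 0 := by
      have h2 : ∑ i, (∑ j, W i j) ^ 2 = ∑ j, ∑ k, ∑ i, W i j * W i k := by
        simp_rw [sq, Finset.sum_mul_sum]
        rw [Finset.sum_comm]
        refine Finset.sum_congr rfl fun j _ => ?_
        rw [Finset.sum_comm]
      rw [h2]
      simp_rw [hent, ← Finset.mul_sum, Finset.sum_sub_distrib]
      simp [hK0]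
    intro i
    have h3 := (Finset.sum_eq_zero_iff_of_nonneg (fun i _ => sq_nonneg (∑ j, W i j))).1 h1 i
      (Finset.mem_univ i)
    exact pow_eq_zero_iff (two_ne_zero) |>.1 h3
  obtain ⟨v, hv0, hv⟩ : ∃ v : Fin d → ℝ, v ≠ 0 ∧ Wᵀ *ᵥ v = 0 := by
    by_contra hcon
    push Not at hcon
    have hinj : Function.Injective (Wᵀ).mulVecLin := by
      rw [injective_iff_map_eq_zero]
      intro a ha
      by_contra h0
      exact hcon a h0 ha
    have hle := LinearMap.finrank_le_finrank_of_injective hinj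
    simp only [Module.finrank_fin_fun] at hle
    have hdK : d = K := le_antisymm hle hd
    subst hdK
    obtain ⟨x, hx⟩ := (LinearMap.injective_iff_surjective.1 hinj) (fun _ => 1)
    have h4 : ∑ j, (Wᵀ *ᵥ x) j = 0 := by
      simp only [Matrix.mulVec, dotProduct, Matrix.transpose_apply]
      rw [Finset.sum_comm]
      simp_rw [← Finset.sum_mul, hrow]
      simp
    have hx' : Wᵀ *ᵥ x = fun _ => 1 := hx
    rw [hx'] at h4
    simp at h4
    exact hK0 (by exact_mod_cast h4)
  have hvW : ∀ j, ∑ i, W i j * v i = 0 := fun j => congrFun hv j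
  have hvv : 0 < ∑ i, v i * v i := by
    refine lt_of_le_of_ne (Finset.sum_nonneg fun i _ => mul_self_nonneg _) ?_
    intro h
    exact hv0 (dotProduct_self_eq_zero.1 h.symm)
  set s := Real.sqrt ((K : ℝ) / ((K : ℝ) - 1)) with hs
  have hpos : 0 < (K : ℝ) / ((K : ℝ) - 1) := by apply div_pos <;> linarith
  have hs0 : 0 < s := Real.sqrt_pos.2 hpos
  have hss : s * s = (K : ℝ) / ((K : ℝ) - 1) := Real.mul_self_sqrt hpos.le
  set q := ∑ i, v i * v i with hq
  obtain ⟨t, ht⟩ : ∃ t : ℝ, t * t * q = (K : ℝ)⁻¹ := by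
    refine ⟨Real.sqrt ((K : ℝ)⁻¹ / q), ?_⟩
    rw [Real.mul_self_sqrt (by positivity)]
    field_simp
  refine ⟨Matrix.of fun i j => s⁻¹ * W i j + t * v i, ?_, ?_⟩
  · ext j k
    have h5 : ∑ i, (s⁻¹ * W i j + t * v i) * (s⁻¹ * W i k + t * v i) =
        s⁻¹ * s⁻¹ * ∑ i, W i j * W i k + s⁻¹ * t * ∑ i, W i j * v i
        + s⁻¹ * t * ∑ i, W i k * v i + t * t * q := by
      rw [hq]
      simp only [Finset.mul_sum, ← Finset.sum_add_distrib]
      exact Finset.sum_congr rfl fun i _ => by ring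
    simp only [Matrix.mul_apply, Matrix.transpose_apply, Matrix.of_apply, Matrix.one_apply]
    rw [h5, hvW, hvW, ht, hent, ← hss]
    field_simp
    ring
  · ext i j
    have h6 : ∑ k, (s⁻¹ * W i k + t * v i) * ((if k = j then 1 else 0) - (K : ℝ)⁻¹) =
        s⁻¹ * W i j := by
      simp only [mul_sub, Finset.sum_sub_distrib, mul_ite, mul_one, mul_zero,
        Finset.sum_ite_eq', Finset.sum_ite_eq, Finset.mem_univ, if_true, ← Finset.sum_mul,
        Finset.sum_add_distrib, ← Finset.mul_sum, hrow]
      simp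
      field_simp
      ring
    simp only [Matrix.smul_apply, Matrix.mul_apply, Matrix.of_apply, Matrix.sub_apply,
      Matrix.one_apply, smul_eq_mul, mul_one]
    rw [h6]
    field_simp
end

section
/- (Equiangular & Maximal Separated Property) Let K ≥ 2, d ≥ K, and let W = [w_1, …, w_K] ∈ ℝ^{d×K} have unit-norm columns, ‖w_k‖ = 1 for all k. Then max_{k ≠ k'} w_k^T w_{k'} ≥ −1/(K−1), and equality holds if and only if W is a simplex equiangular tight frame; in the equality case the configuration is equiangular, i.e., w_k^T w_{k'} = −1/(K−1) is constant over all pairs k ≠ k'. -/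
open Matrix

/-- Rigidity of the Gram matrix: if all off-diagonal entries are at most `-1/(K-1)`, they are
all equal to it, and the columns sum to zero. -/
lemma etf_rigid (K d : ℕ) (hK : 2 ≤ K) (W : Matrix (Fin d) (Fin K) ℝ)
    (h1 : ∀ k, ∑ i, W i k * W i k = 1)
    (hle : ∀ k k', k ≠ k' → ∑ i, W i k * W i k' ≤ -(1 / ((K : ℝ) - 1))) :
    (∀ k k', ∑ i, W i k * W i k' = if k = k' then 1 else -(1 / ((K : ℝ) - 1))) ∧
      ∀ i, ∑ k, W i k = 0 := by
  have hK' : (2 : ℝ) ≤ K := by exact_mod_cast hK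
  have hsum : ∑ k, ∑ k', ∑ i, W i k * W i k' = ∑ i, (∑ k, W i k) ^ 2 := by
    calc ∑ k, ∑ k', ∑ i, W i k * W i k' = ∑ k, ∑ i, ∑ k', W i k * W i k' :=
          Finset.sum_congr rfl fun k _ => Finset.sum_comm
      _ = ∑ i, ∑ k, ∑ k', W i k * W i k' := Finset.sum_comm
      _ = _ := by
          refine Finset.sum_congr rfl fun i _ => ?_
          rw [sq, Finset.sum_mul_sum]
  have hT : ∑ k : Fin K, ∑ k' : Fin K, (if k = k' then (1 : ℝ) else -(1 / ((K : ℝ) - 1))) = 0 := by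
    have : ∀ k k' : Fin K, (if k = k' then (1 : ℝ) else -(1 / ((K : ℝ) - 1)))
        = (if k = k' then 1 + 1 / ((K : ℝ) - 1) else 0) - 1 / ((K : ℝ) - 1) := by
      intro k k'; split_ifs <;> ring
    simp only [this, Finset.sum_sub_distrib, Finset.sum_ite_eq, Finset.mem_univ, if_true,
      Finset.sum_const, Finset.card_univ, Fintype.card_fin, nsmul_eq_mul]
    have : (K : ℝ) - 1 ≠ 0 := by linarith
    field_simp
    ring
  have hpt : ∀ k k', ∑ i, W i k * W i k' ≤ if k = k' then 1 else -(1 / ((K : ℝ) - 1)) := by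
    intro k k'
    split_ifs with h
    · subst h; exact (h1 k).le
    · exact hle k k' h
  have hrow : ∀ k ∈ Finset.univ, ∑ k', ∑ i, W i k * W i k' ≤
      ∑ k' : Fin K, (if k = k' then (1 : ℝ) else -(1 / ((K : ℝ) - 1))) :=
    fun k _ => Finset.sum_le_sum fun k' _ => hpt k k'
  have hnn : 0 ≤ ∑ i, (∑ k, W i k) ^ 2 := Finset.sum_nonneg fun i _ => sq_nonneg _
  have hz : ∑ i, (∑ k, W i k) ^ 2 = 0 := by
    have := Finset.sum_le_sum hrow
    linarith
  refine ⟨fun k k' => ?_, fun i => ?_⟩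
  · have e := (Finset.sum_eq_sum_iff_of_le hrow).1 (by rw [hsum, hz, hT]) k (Finset.mem_univ _)
    exact (Finset.sum_eq_sum_iff_of_le (fun k' _ => hpt k k')).1 e k' (Finset.mem_univ _)
  · have := (Finset.sum_eq_zero_iff_of_nonneg (fun i _ => sq_nonneg _)).1 hz i (Finset.mem_univ _)
    exact pow_eq_zero_iff (two_ne_zero) |>.1 this

lemma etf_orth (K d : ℕ) (hK : 2 ≤ K) (hd : K ≤ d) (W : Matrix (Fin d) (Fin K) ℝ)
    (h0 : ∀ i, ∑ k, W i k = 0) :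
    ∃ u : Fin d → ℝ, (∑ i, u i * u i = 1) ∧ ∀ k, ∑ i, u i * W i k = 0 := by
  have hex : ∃ v : Fin d → ℝ, v ≠ 0 ∧ Wᵀ *ᵥ v = 0 := by
    by_contra! hc
    have hker : LinearMap.ker Wᵀ.mulVecLin = ⊥ := by
      rw [LinearMap.ker_eq_bot']
      intro v hv
      by_contra hne
      exact hc v hne hv
    have r1 := LinearMap.finrank_range_add_finrank_ker Wᵀ.mulVecLin
    have r2 := LinearMap.finrank_range_add_finrank_ker W.mulVecLin
    have r3 : Module.finrank ℝ (LinearMap.range Wᵀ.mulVecLin)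
      = Module.finrank ℝ (LinearMap.range W.mulVecLin) := Matrix.rank_transpose W
    rw [hker, finrank_bot] at r1
    simp only [Module.finrank_fin_fun] at r1 r2
    have hk : Module.finrank ℝ (LinearMap.ker W.mulVecLin) = 0 := by omega
    rw [Submodule.finrank_eq_zero, LinearMap.ker_eq_bot'] at hk
    have := hk (fun _ => 1) (by
      ext i
      simpa [Matrix.mulVec, dotProduct] using h0 i)
    have := congrFun this ⟨0, by omega⟩
    simp at this
  obtain ⟨v, hv, hWv⟩ := hex
  have hpos : 0 < ∑ i, v i * v i := by
    obtain ⟨i, hi⟩ := Function.ne_iff.1 hv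
    exact Finset.sum_pos' (fun i _ => mul_self_nonneg _)
      ⟨i, Finset.mem_univ _, mul_self_pos.2 hi⟩
  have hs := Real.mul_self_sqrt hpos.le
  have hsp := Real.sqrt_pos.2 hpos
  set s := Real.sqrt (∑ i, v i * v i)
  refine ⟨fun i => s⁻¹ * v i, ?_, fun k => ?_⟩
  · have : ∀ i, s⁻¹ * v i * (s⁻¹ * v i) = (s * s)⁻¹ * (v i * v i) := by
      intro i; rw [mul_inv]; ring
    simp only [this]
    rw [← Finset.mul_sum, hs, inv_mul_cancel₀ hpos.ne']
  · have e := congrFun hWv k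
    simp only [Matrix.mulVec, dotProduct, Matrix.transpose_apply, Pi.zero_apply] at e
    have : ∀ i, s⁻¹ * v i * W i k = s⁻¹ * (W i k * v i) := by intro i; ring
    simp only [this]
    rw [← Finset.mul_sum, e, mul_zero]

lemma etf_mul_apply {K d : ℕ} (U : Matrix (Fin d) (Fin K) ℝ) (i : Fin d) (k : Fin K) :
    (U * ((1 : Matrix (Fin K) (Fin K) ℝ) -
      ((K : ℝ))⁻¹ • Matrix.of (fun _ _ => (1 : ℝ))) : Matrix (Fin d) (Fin K) ℝ) i k
      = U i k - (K : ℝ)⁻¹ * ∑ j, U i j := by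
  rw [Matrix.mul_sub, Matrix.mul_one, Matrix.mul_smul]
  simp [Matrix.mul_apply]


/-- **Equiangular & Maximal Separated Property.** For a matrix
`W = [w₁, …, w_K] ∈ ℝ^{d×K}` with unit-norm columns:
`max_{k ≠ k'} wₖᵀ w_{k'} ≥ -1/(K-1)`; equality holds if and only if `W` is a
simplex equiangular tight frame; and in the equality case the configuration is
equiangular: `wₖᵀ w_{k'} = -1/(K-1)` for all `k ≠ k'`. -/
theorem equiangular_maximal_separated (K d : ℕ) (hK : 2 ≤ K) (hd : K ≤ d)
    (W : Matrix (Fin d) (Fin K) ℝ)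
    (hW : ∀ k : Fin K, ‖(WithLp.equiv 2 (Fin d → ℝ)).symm (fun i => W i k)‖ = 1)
    (S : Set ℝ)
    (hS : S = {x : ℝ | ∃ k k' : Fin K, k ≠ k' ∧
      x = (fun i => W i k) ⬝ᵥ (fun i => W i k')}) :
    (∃ k k' : Fin K, k ≠ k' ∧
      -(1 / ((K : ℝ) - 1)) ≤ (fun i => W i k) ⬝ᵥ (fun i => W i k')) ∧
    (IsGreatest S (-(1 / ((K : ℝ) - 1))) ↔
      ∃ U : Matrix (Fin d) (Fin K) ℝ, Uᵀ * U = 1 ∧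
        W = Real.sqrt ((K : ℝ) / ((K : ℝ) - 1)) •
          (U * ((1 : Matrix (Fin K) (Fin K) ℝ) -
            ((K : ℝ))⁻¹ • Matrix.of (fun _ _ => (1 : ℝ))))) ∧
    (IsGreatest S (-(1 / ((K : ℝ) - 1))) →
      ∀ k k' : Fin K, k ≠ k' →
        (fun i => W i k) ⬝ᵥ (fun i => W i k') = -(1 / ((K : ℝ) - 1))) := by
  have hK' : (2 : ℝ) ≤ K := by exact_mod_cast hK
  have hK1 : (K : ℝ) - 1 ≠ 0 := by linarith
  have hK0 : (K : ℝ) ≠ 0 := by linarith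
  have h1 : ∀ k, ∑ i, W i k * W i k = 1 := by
    intro k
    have h := hW k
    rw [EuclideanSpace.norm_eq, Real.sqrt_eq_one] at h
    simpa [sq] using h
  have hub : IsGreatest S (-(1 / ((K : ℝ) - 1))) →
      ∀ k k', k ≠ k' → ∑ i, W i k * W i k' ≤ -(1 / ((K : ℝ) - 1)) := by
    intro hg k k' hkk
    apply hg.2
    rw [hS]
    exact ⟨k, k', hkk, rfl⟩
  have hne : (⟨0, by omega⟩ : Fin K) ≠ ⟨1, by omega⟩ := by simp
  have hc0 : 0 < (K : ℝ) / ((K : ℝ) - 1) := div_pos (by linarith) (by linarith)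
  have hcc := Real.mul_self_sqrt hc0.le
  have hcp := Real.sqrt_pos.2 hc0
  set c := Real.sqrt ((K : ℝ) / ((K : ℝ) - 1)) with hc
  refine ⟨?_, ⟨fun hg => ?_, ?_⟩, fun hg k k' hkk => ?_⟩
  · by_contra! hcon
    have := (etf_rigid K d hK W h1 (fun k k' h => (hcon k k' h).le)).1
      ⟨0, by omega⟩ ⟨1, by omega⟩
    rw [if_neg hne] at this
    exact absurd this (hcon _ _ hne).ne
  · obtain ⟨hG, h0⟩ := etf_rigid K d hK W h1 (hub hg)
    obtain ⟨u, hu1, hu⟩ := etf_orth K d hK hd W h0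
    have hss := Real.mul_self_sqrt (show (0 : ℝ) ≤ K by linarith)
    have hsp := Real.sqrt_pos.2 (show (0 : ℝ) < K by linarith)
    set s := Real.sqrt (K : ℝ)
    refine ⟨Matrix.of fun i k => c⁻¹ * W i k + s⁻¹ * u i, ?_, ?_⟩
    · ext k k'
      rw [Matrix.mul_apply]
      simp only [Matrix.transpose_apply, Matrix.of_apply]
      have : ∀ i, (c⁻¹ * W i k + s⁻¹ * u i) * (c⁻¹ * W i k' + s⁻¹ * u i)
          = (c * c)⁻¹ * (W i k * W i k') + c⁻¹ * s⁻¹ * (u i * W i k) + c⁻¹ * s⁻¹ * (u i * W i k')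
            + (s * s)⁻¹ * (u i * u i) := by
        intro i; rw [mul_inv, mul_inv]; ring
      simp only [this, Finset.sum_add_distrib, ← Finset.mul_sum]
      rw [hu, hu, hu1, hG, hcc, hss, Matrix.one_apply]
      split_ifs <;> field_simp <;> ring
    · ext i k
      rw [Matrix.smul_apply, etf_mul_apply]
      simp only [Matrix.of_apply, Finset.sum_add_distrib, ← Finset.mul_sum, h0 i,
        Finset.sum_const, Finset.card_univ, Fintype.card_fin, nsmul_eq_mul, smul_eq_mul]
      field_simp
      ring
  · rintro ⟨U, hU, hWU⟩
    have hUU : ∀ k k', ∑ i, U i k * U i k' = if k = k' then 1 else 0 := by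
      intro k k'
      have := congrFun (congrFun hU k) k'
      simpa [Matrix.mul_apply, Matrix.one_apply] using this
    have hWi : ∀ i k, W i k = c * (U i k - (K : ℝ)⁻¹ * ∑ j, U i j) := by
      intro i k
      have := congrFun (congrFun hWU i) k
      rw [Matrix.smul_apply, etf_mul_apply] at this
      exact this
    have hA : ∀ k, ∑ i, U i k * ∑ j, U i j = 1 := by
      intro k
      simp only [Finset.mul_sum]
      rw [Finset.sum_comm]
      simp [hUU]
    have hB : ∑ i, (∑ j, U i j) * ∑ j, U i j = K := by
      have : ∀ i, (∑ j, U i j) * ∑ j, U i j = ∑ k, U i k * ∑ j, U i j :=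
        fun i => Finset.sum_mul _ _ _
      simp only [this]
      rw [Finset.sum_comm]
      simp [hA]
    have hoff : ∀ k k', k ≠ k' → ∑ i, W i k * W i k' = -(1 / ((K : ℝ) - 1)) := by
      intro k k' hkk
      have : ∀ i, W i k * W i k' = (c * c) * (U i k * U i k')
          - (c * c) * (K : ℝ)⁻¹ * (U i k * ∑ j, U i j)
          - (c * c) * (K : ℝ)⁻¹ * (U i k' * ∑ j, U i j)
          + (c * c) * (K : ℝ)⁻¹ * (K : ℝ)⁻¹ * ((∑ j, U i j) * ∑ j, U i j) := by
        intro i; rw [hWi, hWi]; ring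
      simp only [this, Finset.sum_add_distrib, Finset.sum_sub_distrib]
      simp only [← Finset.mul_sum _ _ (c * c), ← Finset.mul_sum _ _ (c * c * (K : ℝ)⁻¹),
        ← Finset.mul_sum _ _ (c * c * (K : ℝ)⁻¹ * (K : ℝ)⁻¹)]
      rw [hUU, hA, hA, hB, hcc, if_neg hkk]
      field_simp
      ring
    rw [hS]
    refine ⟨⟨_, _, hne, (hoff _ _ hne).symm⟩, ?_⟩
    rintro x ⟨k, k', hkk, rfl⟩
    exact (hoff k k' hkk).le
  · have := (etf_rigid K d hK W h1 (hub hg)).1 k k'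
    rw [if_neg hkk] at this
    exact this
end

section
/- Let K ≥ 2 and d ≥ K. Suppose M ∈ ℝ^{d×K} satisfies M^T M = I_K − (1/K)·1_K 1_K^T (the centering matrix C_K). Then there exists an orthogonal-column matrix U ∈ ℝ^{d×K} with U^T U = I_K such that M = U·C_K. -/
open Matrix

/-- If `M ∈ ℝ^{d×K}` (with `K ≥ 2`, `d ≥ K`) satisfies
`Mᵀ M = I_K - (1/K)·1_K 1_Kᵀ = C_K` (the centering matrix), then there exists
`U ∈ ℝ^{d×K}` with `Uᵀ U = I_K` such that `M = U · C_K`. -/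
theorem factor_through_centering (K d : ℕ) (hK : 2 ≤ K) (hd : K ≤ d)
    (M : Matrix (Fin d) (Fin K) ℝ)
    (hM : Mᵀ * M = (1 : Matrix (Fin K) (Fin K) ℝ) -
      ((K : ℝ))⁻¹ • Matrix.of (fun _ _ => (1 : ℝ))) :
    ∃ U : Matrix (Fin d) (Fin K) ℝ, Uᵀ * U = 1 ∧
      M = U * ((1 : Matrix (Fin K) (Fin K) ℝ) -
        ((K : ℝ))⁻¹ • Matrix.of (fun _ _ => (1 : ℝ))) := by
  have hK0 : (K : ℝ) ≠ 0 := by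
    have : K ≠ 0 := by omega
    exact_mod_cast this
  have hM1 : M *ᵥ (fun _ => (1 : ℝ)) = 0 := by
    apply dotProduct_self_eq_zero.mp
    rw [Matrix.dotProduct_mulVec, Matrix.vecMul_mulVec, hM]
    simp [Matrix.vecMul, dotProduct, Matrix.sub_apply, Matrix.one_apply, hK0]
  have hrow : ∀ i, ∑ j, M i j = 0 := by
    intro i
    have := congrFun hM1 i
    simpa [Matrix.mulVec, dotProduct] using this
  have hv : ∃ v : Fin d → ℝ, v ≠ 0 ∧ Mᵀ *ᵥ v = 0 := by
    rcases hd.lt_or_eq with h | h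
    · have hk : LinearMap.ker (Mᵀ).mulVecLin ≠ ⊥ := by
        apply LinearMap.ker_ne_bot_of_finrank_lt
        simpa using h
      obtain ⟨v, hv, hv0⟩ := (Submodule.ne_bot_iff _).mp hk
      exact ⟨v, hv0, LinearMap.mem_ker.mp hv⟩
    · subst h
      apply Matrix.exists_mulVec_eq_zero_iff.mpr
      rw [Matrix.det_transpose]
      apply Matrix.exists_mulVec_eq_zero_iff.mp
      refine ⟨_, ?_, hM1⟩
      intro h
      have := congrFun h ⟨0, by omega⟩
      simp at this
  obtain ⟨v, hv0, hv⟩ := hv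
  have hcol : ∀ j, ∑ i, M i j * v i = 0 := by
    intro j
    have := congrFun hv j
    simpa [Matrix.mulVec, dotProduct] using this
  have hq : 0 < ∑ i, v i * v i := by
    have h1 : 0 ≤ ∑ i, v i * v i := Finset.sum_nonneg fun i _ => mul_self_nonneg _
    exact lt_of_le_of_ne h1 fun h => hv0 (dotProduct_self_eq_zero.mp h.symm)
  obtain ⟨c, hc⟩ : ∃ c : ℝ, c * c * (∑ i, v i * v i) = (K : ℝ)⁻¹ := by
    refine ⟨Real.sqrt ((K : ℝ)⁻¹ / ∑ i, v i * v i), ?_⟩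
    rw [Real.mul_self_sqrt (by positivity)]
    exact div_mul_cancel₀ _ hq.ne'
  refine ⟨Matrix.of fun i j => M i j + c * v i, ?_, ?_⟩
  · ext j k
    have h1 := congrFun (congrFun hM j) k
    simp only [Matrix.mul_apply, Matrix.transpose_apply, Matrix.sub_apply, Matrix.smul_apply,
      Matrix.of_apply, smul_eq_mul, mul_one] at h1 ⊢
    have h2 : ∑ i, (M i j + c * v i) * (M i k + c * v i) =
        ∑ i, M i j * M i k + c * ∑ i, M i j * v i + c * ∑ i, M i k * v i
          + c * c * ∑ i, v i * v i := by
      simp only [Finset.mul_sum, ← Finset.sum_add_distrib]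
      exact Finset.sum_congr rfl fun i _ => by ring
    rw [h2, hcol, hcol, hc, h1]
    ring
  · ext i j
    rw [Matrix.mul_sub, Matrix.mul_one]
    simp only [Matrix.mul_smul, Matrix.mul_apply, Matrix.sub_apply, Matrix.smul_apply,
      Matrix.of_apply, smul_eq_mul, mul_one, Finset.sum_add_distrib, hrow]
    simp [hK0]
end
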